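/- Let N be a submultiplicative, unitarily invariant norm on the n×n complex matrices and let α₁, α₂ ∈ [0, π/2). If X ∈ M^s_{n,α₁} and Y ∈ M^s_{n,α₂}, then ω_N(X ∘ Y) ≤ sec(α₁)·sec(α₂)·ω_N(X)·ω_N(Y). -/

import Mathlib

open scoped ComplexOrder Matrix

/-- The Hermitian (real) part of a matrix: `Re(X) = (X + X*)/2`. -/
noncomputable def matRe {n : ℕ} (X : Matrix (Fin n) (Fin n) ℂ) :
    Matrix (Fin n) (Fin n) ℂ :=
  (1 / 2 : ℂ) • (X + Xᴴ)

/-- The skew (imaginary) part of a matrix: `Im(X) = (X - X*)/(2i)`. -/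
noncomputable def matIm {n : ℕ} (X : Matrix (Fin n) (Fin n) ℂ) :
    Matrix (Fin n) (Fin n) ℂ :=
  (1 / (2 * Complex.I)) • (X - Xᴴ)

/-- The generalized numerical radius induced by a norm `N`:
`ω_N(X) = sup_θ N(Re(e^{iθ} X))`. -/
noncomputable def gnr {n : ℕ} (N : Matrix (Fin n) (Fin n) ℂ → ℝ)
    (X : Matrix (Fin n) (Fin n) ℂ) : ℝ :=
  ⨆ θ : ℝ, N (matRe (Complex.exp (θ * Complex.I) • X))

/-- The numerical range `W(X) = {⟨Xx, x⟩ : ‖x‖ = 1}` (standard inner product on ℂⁿ). -/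
def numRange {n : ℕ} (X : Matrix (Fin n) (Fin n) ℂ) : Set ℂ :=
  { z | ∃ x : Fin n → ℂ, star x ⬝ᵥ x = 1 ∧ z = star x ⬝ᵥ X.mulVec x }

/-- The sector `S_α = {z : Re z > 0, |Im z| ≤ tan(α) Re z}`. -/
def sector (α : ℝ) : Set ℂ :=
  { z | 0 < z.re ∧ |z.im| ≤ Real.tan α * z.re }

/-- The class `M^s_{n,α}` of matrices `X` such that `W(zX) ⊆ S_α` for some unimodular `z`. -/
def sectClass (n : ℕ) (α : ℝ) : Set (Matrix (Fin n) (Fin n) ℂ) :=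
  { X | ∃ z : ℂ, ‖z‖ = 1 ∧ numRange (z • X) ⊆ sector α }

/-- The norm hypotheses bundled. -/
structure UIN {n : ℕ} (N : Matrix (Fin n) (Fin n) ℂ → ℝ) : Prop where
  z : ∀ A : Matrix (Fin n) (Fin n) ℂ, N A = 0 ↔ A = 0
  s : ∀ (c : ℂ) (A : Matrix (Fin n) (Fin n) ℂ), N (c • A) = ‖c‖ * N A
  a : ∀ A B : Matrix (Fin n) (Fin n) ℂ, N (A + B) ≤ N A + N B
  u : ∀ U V A : Matrix (Fin n) (Fin n) ℂ, U ∈ Matrix.unitaryGroup (Fin n) ℂ →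
      V ∈ Matrix.unitaryGroup (Fin n) ℂ → N (U * A * V) = N A
  m : ∀ A B : Matrix (Fin n) (Fin n) ℂ, N (A * B) ≤ N A * N B

lemma UIN.nonneg {n : ℕ} {N : Matrix (Fin n) (Fin n) ℂ → ℝ} (h : UIN N)
    (A : Matrix (Fin n) (Fin n) ℂ) : 0 ≤ N A := by
  have h1 := h.a A ((-1 : ℂ) • A)
  have h2 : A + (-1 : ℂ) • A = 0 := by simp
  rw [h2, (h.z 0).2 rfl, h.s] at h1
  simp at h1
  exact h1

lemma UIN.sum_le {n : ℕ} {N : Matrix (Fin n) (Fin n) ℂ → ℝ} (h : UIN N)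
    {ι : Type*} (s : Finset ι) (f : ι → Matrix (Fin n) (Fin n) ℂ) :
    N (∑ i ∈ s, f i) ≤ ∑ i ∈ s, N (f i) := by
  classical
  induction s using Finset.induction_on with
  | empty => simp [(h.z 0).2 rfl]
  | insert a s ha ih =>
    rw [Finset.sum_insert ha, Finset.sum_insert ha]
    exact (h.a _ _).trans (by linarith)

lemma diag_unitary {n : ℕ} (d : Fin n → ℂ) (hd : ∀ i, ‖d i‖ = 1) :
    Matrix.diagonal d ∈ Matrix.unitaryGroup (Fin n) ℂ := by
  rw [Matrix.mem_unitaryGroup_iff, Matrix.star_eq_conjTranspose, Matrix.diagonal_conjTranspose,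
    Matrix.diagonal_mul_diagonal, ← Matrix.diagonal_one]
  congr 1
  ext i
  simp [Complex.mul_conj, Complex.normSq_eq_norm_sq, hd i]

lemma pm_sign_sum {n : ℕ} (i j : Fin n) (hij : i ≠ j) :
    ∑ s : Fin n → ℤˣ, (((s i : ℤ) : ℂ) * ((s j : ℤ) : ℂ)) = 0 := by
  have h := Equiv.sum_comp (Equiv.mulLeft (Function.update (1 : Fin n → ℤˣ) i (-1)))
    (fun s : Fin n → ℤˣ => (((s i : ℤ) : ℂ) * ((s j : ℤ) : ℂ)))
  simp [Function.update_of_ne hij.symm] at h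
  have : ∑ s : Fin n → ℤˣ, (((s i : ℤ) : ℂ) * ((s j : ℤ) : ℂ)) =
    - ∑ s : Fin n → ℤˣ, (((s i : ℤ) : ℂ) * ((s j : ℤ) : ℂ)) := by
    simpa using h.symm
  exact self_eq_neg.mp this

lemma UIN.pinch {n : ℕ} {N : Matrix (Fin n) (Fin n) ℂ → ℝ} (h : UIN N)
    (A : Matrix (Fin n) (Fin n) ℂ) : N (Matrix.diagonal fun i => A i i) ≤ N A := by
  set D : (Fin n → ℤˣ) → Matrix (Fin n) (Fin n) ℂ :=
    fun s => Matrix.diagonal fun i => ((s i : ℤ) : ℂ) with hD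
  have hDu : ∀ s, D s ∈ Matrix.unitaryGroup (Fin n) ℂ := by
    intro s
    apply diag_unitary
    intro i
    rcases Int.units_eq_one_or (s i) with h | h <;> simp [h]
  have hc : (0 : ℝ) < Fintype.card (Fin n → ℤˣ) := by exact_mod_cast Fintype.card_pos
  have key : ((Fintype.card (Fin n → ℤˣ) : ℝ) : ℂ) • (Matrix.diagonal fun i => A i i) =
      ∑ s, D s * A * D s := by
    ext i j
    rw [Matrix.sum_apply]
    simp only [hD, Matrix.diagonal_mul, Matrix.mul_diagonal, Matrix.smul_apply]
    by_cases hij : i = j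
    · subst hij
      have : ∀ s : Fin n → ℤˣ, ((s i : ℤ) : ℂ) * A i i * ((s i : ℤ) : ℂ) = A i i := by
        intro s
        rcases Int.units_eq_one_or (s i) with h | h <;> simp [h]
      simp only [this, Matrix.diagonal_apply_eq, Finset.sum_const, smul_eq_mul, nsmul_eq_mul]
      simp
    · have : ∀ s : Fin n → ℤˣ, ((s i : ℤ) : ℂ) * A i j * ((s j : ℤ) : ℂ)
        = A i j * (((s i : ℤ) : ℂ) * ((s j : ℤ) : ℂ)) := by intro s; ring
      simp only [this]
      rw [← Finset.mul_sum, pm_sign_sum i j hij, Matrix.diagonal_apply_ne _ hij]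
      simp
  have h1 := h.sum_le Finset.univ (fun s => D s * A * D s)
  rw [← key, h.s] at h1
  simp only [h.u _ _ A (hDu _) (hDu _)] at h1
  rw [Complex.norm_real, Real.norm_of_nonneg hc.le, Finset.sum_const, nsmul_eq_mul,
    Finset.card_univ] at h1
  exact le_of_mul_le_mul_left h1 hc

lemma UIN.diag_mono {n : ℕ} {N : Matrix (Fin n) (Fin n) ℂ → ℝ} (h : UIN N)
    (p q : Fin n → ℝ) (hpq : ∀ i, |p i| ≤ q i) :
    N (Matrix.diagonal fun i => (p i : ℂ)) ≤ N (Matrix.diagonal fun i => (q i : ℂ)) := by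
  have ex : ∀ i, ∃ w : ℂ, ‖w‖ = 1 ∧ (p i : ℂ) = w.re * (q i : ℂ) := by
    intro i
    by_cases hq : q i = 0
    · refine ⟨1, by simp, ?_⟩
      have := hpq i
      rw [hq] at this
      simp [hq, abs_nonpos_iff.1 this]
    · have hq' : 0 < q i := lt_of_le_of_ne ((abs_nonneg _).trans (hpq i)) (Ne.symm hq)
      have hd : |p i / q i| ≤ 1 := by
        rw [abs_div, abs_of_pos hq', div_le_one hq']; exact hpq i
      refine ⟨⟨p i / q i, Real.sqrt (1 - (p i / q i)^2)⟩, ?_, ?_⟩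
      · rw [Complex.norm_def, Complex.normSq_mk, Real.mul_self_sqrt, Real.sqrt_eq_one]
        · ring
        · have := (sq_le_one_iff_abs_le_one _).2 hd
          linarith
      · rw [← Complex.ofReal_mul, div_mul_cancel₀ _ hq]
  choose w hw1 hw2 using ex
  set Q : Matrix (Fin n) (Fin n) ℂ := Matrix.diagonal fun i => (q i : ℂ) with hQ
  have e : (Matrix.diagonal fun i => (p i : ℂ)) = (1/2 : ℂ) • (Matrix.diagonal w * Q * 1 +
      Matrix.diagonal (fun i => star (w i)) * Q * 1) := by
    rw [hQ, mul_one, mul_one, Matrix.diagonal_mul_diagonal, Matrix.diagonal_mul_diagonal,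
      Matrix.diagonal_add, ← Matrix.diagonal_smul]
    congr 1
    ext i
    rw [hw2 i, Complex.re_eq_add_conj]
    simp
    ring
  rw [e, h.s]
  have h1 := h.a (Matrix.diagonal w * Q * 1) (Matrix.diagonal (fun i => star (w i)) * Q * 1)
  rw [h.u _ _ _ (diag_unitary w hw1) (one_mem _),
    h.u _ _ _ (diag_unitary _ (by intro i; rw [norm_star]; exact hw1 i)) (one_mem _)] at h1
  have : ‖(1/2 : ℂ)‖ = 1/2 := by norm_num
  rw [this]
  linarith

lemma herm_spec {n : ℕ} {H : Matrix (Fin n) (Fin n) ℂ} (hH : H.IsHermitian) :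
    ∃ (U : Matrix (Fin n) (Fin n) ℂ) (l : Fin n → ℝ), U ∈ Matrix.unitaryGroup (Fin n) ℂ ∧
      Uᴴ ∈ Matrix.unitaryGroup (Fin n) ℂ ∧ Uᴴ * U = 1 ∧ U * Uᴴ = 1 ∧
      H = U * Matrix.diagonal (fun i => (l i : ℂ)) * Uᴴ ∧
      Uᴴ * H * U = Matrix.diagonal (fun i => (l i : ℂ)) := by
  have hU := hH.eigenvectorUnitary.2
  have h1 : (hH.eigenvectorUnitary : Matrix (Fin n) (Fin n) ℂ)ᴴ * hH.eigenvectorUnitary = 1 :=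
    Matrix.mem_unitaryGroup_iff'.1 hU
  have h2 : (hH.eigenvectorUnitary : Matrix (Fin n) (Fin n) ℂ) *
    (hH.eigenvectorUnitary : Matrix (Fin n) (Fin n) ℂ)ᴴ = 1 := Matrix.mem_unitaryGroup_iff.1 hU
  have h3 : H = hH.eigenvectorUnitary * Matrix.diagonal (fun i => (hH.eigenvalues i : ℂ)) *
     (hH.eigenvectorUnitary : Matrix (Fin n) (Fin n) ℂ)ᴴ := by
    conv_lhs => rw [hH.spectral_theorem]
    rfl
  refine ⟨hH.eigenvectorUnitary, hH.eigenvalues, hU, ?_, h1, h2, h3, ?_⟩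
  · exact Matrix.mem_unitaryGroup_iff'.2 (by simpa [Matrix.star_eq_conjTranspose] using h2)
  · generalize (hH.eigenvectorUnitary : Matrix (Fin n) (Fin n) ℂ) = U at *
    generalize (Matrix.diagonal (fun i => (hH.eigenvalues i : ℂ))) = L at *
    rw [h3]
    calc Uᴴ * (U * L * Uᴴ) * U = (Uᴴ * U) * L * (Uᴴ * U) := by simp only [Matrix.mul_assoc]
      _ = L := by rw [h1]; simp

lemma UIN.mono {n : ℕ} {N : Matrix (Fin n) (Fin n) ℂ → ℝ} (h : UIN N)
    {H P : Matrix (Fin n) (Fin n) ℂ} (hH : H.IsHermitian)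
    (h1 : (P - H).PosSemidef) (h2 : (P + H).PosSemidef) : N H ≤ N P := by
  obtain ⟨U, l, hU, hU', -, -, e, e'⟩ := herm_spec hH
  have g1 := h1.conjTranspose_mul_mul_same U
  have g2 := h2.conjTranspose_mul_mul_same U
  rw [Matrix.mul_sub, Matrix.sub_mul, e'] at g1
  rw [Matrix.mul_add, Matrix.add_mul, e'] at g2
  set P' := Uᴴ * P * U with hP'
  have d1 : ∀ i, 0 ≤ P' i i - (l i : ℂ) := fun i => by simpa using g1.diag_nonneg (i := i)
  have d2 : ∀ i, 0 ≤ P' i i + (l i : ℂ) := fun i => by simpa using g2.diag_nonneg (i := i)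
  have k1 : N H = N (Matrix.diagonal fun i => (l i : ℂ)) := by
    conv_lhs => rw [e]
    exact h.u _ _ _ hU hU'
  have k2 : N P' = N P := h.u _ _ _ hU' hU
  have k3 : (Matrix.diagonal fun i => P' i i) = Matrix.diagonal fun i => (((P' i i).re : ℝ) : ℂ) := by
    congr 1
    ext i
    have := (Complex.le_def.1 (d1 i)).2
    apply Complex.ext <;> simp at this ⊢
    exact this.symm
  rw [k1, ← k2]
  refine le_trans ?_ (h.pinch P')
  rw [k3]
  apply h.diag_mono
  intro i
  have a1 := (Complex.le_def.1 (d1 i)).1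
  have a2 := (Complex.le_def.1 (d2 i)).1
  simp at a1 a2
  exact abs_le.2 ⟨by linarith, by linarith⟩

lemma UIN.le_smul {n : ℕ} {N : Matrix (Fin n) (Fin n) ℂ → ℝ} (h : UIN N)
    {Q : Matrix (Fin n) (Fin n) ℂ} (hQ : Q.IsHermitian) :
    (((N Q : ℝ) : ℂ) • (1 : Matrix (Fin n) (Fin n) ℂ) - Q).PosSemidef := by
  obtain ⟨U, l, hU, hU', e1, e2, e, e'⟩ := herm_spec hQ
  have k1 : N Q = N (Matrix.diagonal fun i => (l i : ℂ)) := by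
    conv_lhs => rw [e]
    exact h.u _ _ _ hU hU'
  have hl : ∀ i, l i ≤ N Q := by
    intro i
    set E : Matrix (Fin n) (Fin n) ℂ := Matrix.diagonal (Pi.single i 1) with hE
    have hE0 : E ≠ 0 := by
      intro h0
      have := congrFun (congrFun h0 i) i
      simp [hE] at this
    have hEp : 0 < N E := lt_of_le_of_ne (h.nonneg E) fun h0 => hE0 ((h.z _).1 h0.symm)
    have h1 := h.m (Matrix.diagonal fun i => (l i : ℂ)) E
    have h2 : (Matrix.diagonal fun i => (l i : ℂ)) * E = (l i : ℂ) • E := by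
      rw [hE, Matrix.diagonal_mul_diagonal, ← Matrix.diagonal_smul]
      congr 1
      ext j
      by_cases hj : j = i
      · subst hj; simp
      · simp [hj]
    rw [h2, h.s, ← k1] at h1
    have h3 := le_of_mul_le_mul_right h1 hEp
    rw [Complex.norm_real] at h3
    exact (le_abs_self _).trans h3
  have : ((N Q : ℝ) : ℂ) • (1 : Matrix (Fin n) (Fin n) ℂ) - Q =
      U * (Matrix.diagonal fun i => ((N Q - l i : ℝ) : ℂ)) * Uᴴ := by
    have : (Matrix.diagonal fun i => ((N Q - l i : ℝ) : ℂ)) =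
       ((N Q : ℝ) : ℂ) • (1 : Matrix (Fin n) (Fin n) ℂ) - Matrix.diagonal fun i => (l i : ℂ) := by
      rw [← Matrix.diagonal_one, ← Matrix.diagonal_smul, Matrix.diagonal_sub]
      congr 1
      ext i; simp
    rw [this, Matrix.mul_sub, Matrix.sub_mul, ← e]
    simp [e2]
  rw [this]
  refine Matrix.PosSemidef.mul_mul_conjTranspose_same ?_ U
  refine Matrix.PosSemidef.diagonal ?_
  intro i
  exact Complex.zero_le_real.2 (sub_nonneg.2 (hl i))

lemma UIN.hadamard_le {n : ℕ} {N : Matrix (Fin n) (Fin n) ℂ → ℝ} (h : UIN N)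
    {R Q : Matrix (Fin n) (Fin n) ℂ} (hR : R.PosSemidef) (hQ : Q.PosSemidef) :
    N (Matrix.hadamard R Q) ≤ N R * N Q := by
  have h0 := hR.hadamard hQ
  have h1 := hR.hadamard (h.le_smul hQ.1)
  have e : Matrix.hadamard R (((N Q : ℝ) : ℂ) • (1 : Matrix (Fin n) (Fin n) ℂ) - Q) =
      ((N Q : ℝ) : ℂ) • (Matrix.diagonal fun i => R i i) - Matrix.hadamard R Q := by
    ext i j
    by_cases hij : i = j
    · subst hij; simp; ring
    · simp [hij]
  rw [e] at h1
  have h2 := (h1.add h0).add h0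
  rw [sub_add_cancel] at h2
  refine (h.mono h0.1 h1 h2).trans ?_
  rw [h.s, Complex.norm_real, Real.norm_of_nonneg (h.nonneg Q), mul_comm]
  exact mul_le_mul_of_nonneg_right (h.pinch R) (h.nonneg Q)

lemma sect_pos {n : ℕ} {α : ℝ} {A : Matrix (Fin n) (Fin n) ℂ} (hA : numRange A ⊆ sector α)
    (x : Fin n → ℂ) (hx : x ≠ 0) : 0 < (star x ⬝ᵥ A.mulVec x).re ∧
      |(star x ⬝ᵥ A.mulVec x).im| ≤ Real.tan α * (star x ⬝ᵥ A.mulVec x).re := by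
  have hp : 0 < star x ⬝ᵥ x := Matrix.dotProduct_star_self_pos_iff.2 hx
  obtain ⟨hp1, hp2⟩ := Complex.lt_def.1 hp
  set t := (star x ⬝ᵥ x).re with ht
  have hxx : star x ⬝ᵥ x = (t : ℂ) := by
    apply Complex.ext <;> simp [ht]
    exact hp2.symm
  simp only [Complex.zero_re] at hp1
  set r := (Real.sqrt t)⁻¹ with hr
  have hr0 : 0 < r := by positivity
  have hrt : r * r * t = 1 := by
    rw [hr, ← mul_inv, Real.mul_self_sqrt hp1.le, inv_mul_cancel₀ hp1.ne']
  have hs : star ((r : ℂ) • x) = (r : ℂ) • star x := by simp [star_smul]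
  have := hA (a := star ((r : ℂ) • x) ⬝ᵥ A.mulVec ((r : ℂ) • x)) ⟨(r : ℂ) • x, by
    rw [hs, smul_dotProduct, dotProduct_smul, hxx, smul_eq_mul, smul_eq_mul]
    rw [← mul_assoc]
    exact_mod_cast hrt, rfl⟩
  rw [hs, smul_dotProduct, Matrix.mulVec_smul, dotProduct_smul, smul_eq_mul, smul_eq_mul,
    ← mul_assoc, ← Complex.ofReal_mul] at this
  obtain ⟨a, b⟩ := this
  rw [Complex.re_ofReal_mul] at a b
  rw [Complex.im_ofReal_mul, abs_mul, abs_of_pos (mul_pos hr0 hr0)] at b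
  have hrr := mul_pos hr0 hr0
  refine ⟨(mul_pos_iff_of_pos_left hrr).1 a, ?_⟩
  refine le_of_mul_le_mul_left ?_ hrr
  linarith

lemma quad_star {n : ℕ} (A : Matrix (Fin n) (Fin n) ℂ) (x : Fin n → ℂ) :
    star x ⬝ᵥ Aᴴ.mulVec x = star (star x ⬝ᵥ A.mulVec x) := by
  rw [Matrix.dotProduct_mulVec, ← Matrix.star_mulVec, Matrix.star_dotProduct]

lemma matRe_herm {n : ℕ} (A : Matrix (Fin n) (Fin n) ℂ) : (matRe A).IsHermitian := by
  unfold matRe Matrix.IsHermitian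
  simp [Matrix.conjTranspose_smul, add_comm]

lemma matIm_herm {n : ℕ} (A : Matrix (Fin n) (Fin n) ℂ) : (matIm A).IsHermitian := by
  unfold matIm Matrix.IsHermitian
  simp [Matrix.conjTranspose_smul]
  rw [← neg_sub A, smul_neg]

lemma re_add_im {n : ℕ} (A : Matrix (Fin n) (Fin n) ℂ) : A = matRe A + Complex.I • matIm A := by
  unfold matRe matIm
  rw [smul_smul]
  have : Complex.I * (1 / (2 * Complex.I)) = 1/2 := by field_simp [Complex.I_ne_zero]
  rw [this]
  ext i j
  simp
  ring

lemma sect_posDef {n : ℕ} {α : ℝ} {A : Matrix (Fin n) (Fin n) ℂ} (hA : numRange A ⊆ sector α) :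
    (matRe A).PosDef := by
  refine Matrix.PosDef.of_dotProduct_mulVec_pos (matRe_herm A) ?_
  intro x hx
  have h := (sect_pos hA x hx).1
  have e : star x ⬝ᵥ (matRe A).mulVec x = (((star x ⬝ᵥ A.mulVec x).re : ℝ) : ℂ) := by
    unfold matRe
    rw [Matrix.smul_mulVec, dotProduct_smul, Matrix.add_mulVec, dotProduct_add, quad_star,
      Complex.re_eq_add_conj, smul_eq_mul]
    simp
    ring
  rw [e]
  exact Complex.zero_lt_real.2 h

lemma sect_decomp {n : ℕ} {α : ℝ} {A : Matrix (Fin n) (Fin n) ℂ} (hA : numRange A ⊆ sector α) :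
    ∃ (C : Matrix (Fin n) (Fin n) ℂ) (k : Fin n → ℝ),
      A = Cᴴ * Matrix.diagonal (fun i => 1 + Complex.I * (k i : ℂ)) * C ∧
      matRe A = Cᴴ * C ∧ ∀ i, |k i| ≤ Real.tan α := by
  have hR := sect_posDef hA
  obtain ⟨B, hBu, hB⟩ : ∃ B : Matrix (Fin n) (Fin n) ℂ, IsUnit B ∧ matRe A = Bᴴ * B := by
    open scoped MatrixOrder in
    exact CStarAlgebra.isStrictlyPositive_iff_eq_star_mul_self.mp hR.isStrictlyPositive
  have hBd : IsUnit B.det := (Matrix.isUnit_iff_isUnit_det B).1 hBu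
  have b1 : B * B⁻¹ = 1 := Matrix.mul_nonsing_inv B hBd
  have b2 : B⁻¹ * B = 1 := Matrix.nonsing_inv_mul B hBd
  have b3 : Bᴴ * (B⁻¹)ᴴ = 1 := by rw [← Matrix.conjTranspose_mul, b2, Matrix.conjTranspose_one]
  have b4 : (B⁻¹)ᴴ * Bᴴ = 1 := by rw [← Matrix.conjTranspose_mul, b1, Matrix.conjTranspose_one]
  obtain ⟨U, k, hU, hU', u1, u2, e, e'⟩ :=
    herm_spec (Matrix.isHermitian_conjTranspose_mul_mul B⁻¹ (matIm_herm A))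
  set L : Matrix (Fin n) (Fin n) ℂ := Matrix.diagonal fun i => (k i : ℂ) with hL
  have hS : matIm A = (Uᴴ * B)ᴴ * L * (Uᴴ * B) := by
    rw [Matrix.conjTranspose_mul, Matrix.conjTranspose_conjTranspose]
    calc matIm A = (Bᴴ * (B⁻¹)ᴴ) * matIm A * (B⁻¹ * B) := by rw [b3, b2]; simp
      _ = Bᴴ * ((B⁻¹)ᴴ * matIm A * B⁻¹) * B := by simp only [Matrix.mul_assoc]
      _ = Bᴴ * U * L * (Uᴴ * B) := by rw [e]; simp only [Matrix.mul_assoc]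
  have hRe : matRe A = (Uᴴ * B)ᴴ * (Uᴴ * B) := by
    rw [Matrix.conjTranspose_mul, Matrix.conjTranspose_conjTranspose, hB]
    calc Bᴴ * B = Bᴴ * (U * Uᴴ) * B := by rw [u2]; simp
      _ = Bᴴ * U * (Uᴴ * B) := by simp only [Matrix.mul_assoc]
  have hI : (Uᴴ * B) * (B⁻¹ * U) = 1 := by
    calc (Uᴴ * B) * (B⁻¹ * U) = Uᴴ * (B * B⁻¹) * U := by simp only [Matrix.mul_assoc]
      _ = 1 := by rw [b1]; simp [u1]
  set C := Uᴴ * B with hC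
  have hD : (Matrix.diagonal fun i => 1 + Complex.I * (k i : ℂ)) = 1 + Complex.I • L := by
    rw [hL, ← Matrix.diagonal_one, ← Matrix.diagonal_smul, Matrix.diagonal_add]
    rfl
  have hdec : A = Cᴴ * Matrix.diagonal (fun i => 1 + Complex.I * (k i : ℂ)) * C := by
    rw [hD, Matrix.mul_add, Matrix.add_mul, Matrix.mul_one, ← hRe, Matrix.mul_smul,
      Matrix.smul_mul, ← hS]
    exact re_add_im A
  refine ⟨C, k, hdec, hRe, ?_⟩
  intro i
  set x : Fin n → ℂ := (B⁻¹ * U).mulVec (Pi.single i 1) with hx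
  have hCx : C.mulVec x = Pi.single i 1 := by
    rw [hx, Matrix.mulVec_mulVec, hI, Matrix.one_mulVec]
  have hx0 : x ≠ 0 := by
    intro h0
    rw [h0, Matrix.mulVec_zero] at hCx
    have := congrFun hCx i
    simp at this
  have hq : star x ⬝ᵥ A.mulVec x = 1 + Complex.I * (k i : ℂ) := by
    have h1 : A.mulVec x = Cᴴ.mulVec ((Matrix.diagonal
        (fun i => 1 + Complex.I * (k i : ℂ))).mulVec (C.mulVec x)) := by
      conv_lhs => rw [hdec]
      simp only [← Matrix.mulVec_mulVec]
    rw [h1, Matrix.dotProduct_mulVec, ← Matrix.star_mulVec, hCx]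
    simp [dotProduct, Pi.single_apply, Matrix.mulVec_single]
  have := (sect_pos hA x hx0).2
  rw [hq] at this
  simpa using this

lemma norm_le_sec {α k : ℝ} (h0 : 0 ≤ α) (h1 : α < Real.pi / 2) (hk : |k| ≤ Real.tan α) :
    ‖1 + Complex.I * (k : ℂ)‖ ≤ (Real.cos α)⁻¹ := by
  have hc : 0 < Real.cos α := Real.cos_pos_of_mem_Ioo ⟨by linarith [Real.pi_pos], h1⟩
  have ht := Real.inv_one_add_tan_sq hc.ne'
  have hk2 : k ^ 2 ≤ Real.tan α ^ 2 := sq_le_sq' (abs_le.1 hk).1 (abs_le.1 hk).2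
  refine abs_le_of_sq_le_sq' ?_ (inv_pos.2 hc).le |>.2
  rw [← Complex.normSq_eq_norm_sq, inv_pow, ← ht, inv_inv, Complex.normSq_apply]
  simp
  nlinarith

lemma main_bound {n : ℕ} {N : Matrix (Fin n) (Fin n) ℂ → ℝ} (h : UIN N) {α₁ α₂ : ℝ}
    (hα₁0 : 0 ≤ α₁) (hα₁1 : α₁ < Real.pi / 2)
    (hα₂0 : 0 ≤ α₂) (hα₂1 : α₂ < Real.pi / 2)
    (A B : Matrix (Fin n) (Fin n) ℂ)
    (hA : numRange A ⊆ sector α₁) (hB : numRange B ⊆ sector α₂) (c : ℂ) (hc : ‖c‖ = 1) :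
    N (matRe (c • Matrix.hadamard A B)) ≤
      (Real.cos α₁)⁻¹ * (Real.cos α₂)⁻¹ * N (matRe A) * N (matRe B) := by
  obtain ⟨C, k, hAd, hAr, hk⟩ := sect_decomp hA
  obtain ⟨F, l, hBd, hBr, hl⟩ := sect_decomp hB
  set s : ℝ := (Real.cos α₁)⁻¹ * (Real.cos α₂)⁻¹ with hs
  have hs0 : 0 ≤ s := mul_nonneg
    ((norm_nonneg _).trans (norm_le_sec hα₁0 hα₁1 (k := 0)
      (by simpa using Real.tan_nonneg_of_nonneg_of_le_pi_div_two hα₁0 hα₁1.le)))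
    ((norm_nonneg _).trans (norm_le_sec hα₂0 hα₂1 (k := 0)
      (by simpa using Real.tan_nonneg_of_nonneg_of_le_pi_div_two hα₂0 hα₂1.le)))
  set G : Matrix (Fin n × Fin n) (Fin n) ℂ := fun jm q => C jm.1 q * F jm.2 q with hG
  have had : ∀ (a b : Fin n → ℂ), Matrix.hadamard (Cᴴ * Matrix.diagonal a * C)
      (Fᴴ * Matrix.diagonal b * F) =
      Gᴴ * Matrix.diagonal (fun jm : Fin n × Fin n => a jm.1 * b jm.2) * G := by
    intro a b
    ext p q
    rw [Matrix.hadamard_apply, Matrix.mul_apply, Matrix.mul_apply, Matrix.mul_apply,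
      Finset.sum_mul_sum, Fintype.sum_prod_type]
    refine Finset.sum_congr rfl fun i _ => Finset.sum_congr rfl fun j _ => ?_
    have hg : Gᴴ p (i, j) = star (C i p) * star (F j p) := by
      rw [Matrix.conjTranspose_apply, hG, star_mul']
    rw [Matrix.mul_diagonal, Matrix.mul_diagonal, Matrix.mul_diagonal, hg,
      Matrix.conjTranspose_apply, Matrix.conjTranspose_apply]
    simp only [hG]
    ring
  set w : Fin n × Fin n → ℂ := fun jm =>
    (1 + Complex.I * (k jm.1 : ℂ)) * (1 + Complex.I * (l jm.2 : ℂ)) with hw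
  have hwn : ∀ jm, |(c * w jm).re| ≤ s := by
    intro jm
    refine (Complex.abs_re_le_norm _).trans ?_
    rw [norm_mul, hc, one_mul, hw, norm_mul]
    exact mul_le_mul (norm_le_sec hα₁0 hα₁1 (hk _)) (norm_le_sec hα₂0 hα₂1 (hl _))
      (norm_nonneg _) ((norm_nonneg _).trans (norm_le_sec hα₁0 hα₁1 (hk jm.1)))
  have eAB : Matrix.hadamard A B = Gᴴ * Matrix.diagonal w * G := by
    conv_lhs => rw [hAd, hBd]
    exact had _ _
  have eR : Matrix.hadamard (matRe A) (matRe B) = Gᴴ * G := by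
    have := had 1 1
    simp only [Pi.one_apply, mul_one] at this
    rw [hAr, hBr]
    have h1 : Matrix.diagonal (1 : Fin n → ℂ) = 1 := Matrix.diagonal_one
    have h2 : Matrix.diagonal (fun _ : Fin n × Fin n => (1 : ℂ)) = 1 := Matrix.diagonal_one
    rwa [h1, h2, Matrix.mul_one, Matrix.mul_one, Matrix.mul_one] at this
  have eH : matRe (c • Matrix.hadamard A B) =
      Gᴴ * Matrix.diagonal (fun jm => (((c * w jm).re : ℝ) : ℂ)) * G := by
    have hd : Matrix.diagonal (fun jm => (((c * w jm).re : ℝ) : ℂ)) = (1/2 : ℂ) •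
        (c • Matrix.diagonal w + (c • Matrix.diagonal w)ᴴ) := by
      rw [← Matrix.diagonal_smul, Matrix.diagonal_conjTranspose, Matrix.diagonal_add,
        ← Matrix.diagonal_smul]
      congr 1
      ext jm
      rw [Complex.re_eq_add_conj]
      simp
      ring
    rw [hd, eAB]
    unfold matRe
    simp only [Matrix.conjTranspose_smul, Matrix.conjTranspose_mul,
      Matrix.conjTranspose_conjTranspose, Matrix.mul_add, Matrix.add_mul, Matrix.mul_smul,
      Matrix.smul_mul, Matrix.mul_assoc]
  have eP : (s : ℂ) • Matrix.hadamard (matRe A) (matRe B) =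
      Gᴴ * Matrix.diagonal (fun _ : Fin n × Fin n => (s : ℂ)) * G := by
    rw [eR]
    have : Matrix.diagonal (fun _ : Fin n × Fin n => (s : ℂ)) = (s : ℂ) • 1 := by
      rw [← Matrix.diagonal_one, ← Matrix.diagonal_smul]
      congr 1
      ext; simp
    rw [this]
    simp
  have p1 : ((s : ℂ) • Matrix.hadamard (matRe A) (matRe B)
      - matRe (c • Matrix.hadamard A B)).PosSemidef := by
    rw [eH, eP, ← Matrix.sub_mul, ← Matrix.mul_sub, Matrix.diagonal_sub]
    refine Matrix.PosSemidef.conjTranspose_mul_mul_same (Matrix.PosSemidef.diagonal ?_) G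
    intro jm
    show (0 : ℂ) ≤ (s : ℂ) - (((c * w jm).re : ℝ) : ℂ)
    rw [← Complex.ofReal_sub]
    exact Complex.zero_le_real.2 (by linarith [(abs_le.1 (hwn jm)).2])
  have p2 : ((s : ℂ) • Matrix.hadamard (matRe A) (matRe B)
      + matRe (c • Matrix.hadamard A B)).PosSemidef := by
    rw [eH, eP, ← Matrix.add_mul, ← Matrix.mul_add, Matrix.diagonal_add]
    refine Matrix.PosSemidef.conjTranspose_mul_mul_same (Matrix.PosSemidef.diagonal ?_) G
    intro jm
    show (0 : ℂ) ≤ (s : ℂ) + (((c * w jm).re : ℝ) : ℂ)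
    rw [← Complex.ofReal_add]
    exact Complex.zero_le_real.2 (by linarith [(abs_le.1 (hwn jm)).1])
  refine (h.mono (matRe_herm _) p1 p2).trans ?_
  rw [h.s, Complex.norm_real, Real.norm_of_nonneg hs0, mul_assoc s]
  exact mul_le_mul_of_nonneg_left
    (h.hadamard_le (sect_posDef hA).posSemidef (sect_posDef hB).posSemidef) hs0

lemma UIN.le_gnr {n : ℕ} {N : Matrix (Fin n) (Fin n) ℂ → ℝ} (h : UIN N)
    (X : Matrix (Fin n) (Fin n) ℂ) (z : ℂ) (hz : ‖z‖ = 1) : N (matRe (z • X)) ≤ gnr N X := by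
  have hb : BddAbove (Set.range fun θ : ℝ => N (matRe (Complex.exp (θ * Complex.I) • X))) := by
    refine ⟨(1/2) * (N X + N Xᴴ), ?_⟩
    rintro _ ⟨θ, rfl⟩
    have hn := Complex.norm_exp_ofReal_mul_I θ
    show N (matRe _) ≤ _
    unfold matRe
    rw [h.s, Matrix.conjTranspose_smul]
    have h1 := h.a (Complex.exp (θ * Complex.I) • X) (star (Complex.exp (θ * Complex.I)) • Xᴴ)
    rw [h.s, h.s, norm_star, hn] at h1
    have : ‖(1/2 : ℂ)‖ = 1/2 := by norm_num
    rw [this]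
    linarith
  have hz' : Complex.exp ((Complex.arg z : ℝ) * Complex.I) = z := by
    have := Complex.norm_mul_exp_arg_mul_I z
    rwa [hz, Complex.ofReal_one, one_mul] at this
  have := le_ciSup hb (Complex.arg z)
  simp only [hz'] at this
  exact this

theorem stmt_10 {n : ℕ} (N : Matrix (Fin n) (Fin n) ℂ → ℝ)
    (hN0 : ∀ A : Matrix (Fin n) (Fin n) ℂ, N A = 0 ↔ A = 0)
    (hNs : ∀ (c : ℂ) (A : Matrix (Fin n) (Fin n) ℂ), N (c • A) = ‖c‖ * N A)
    (hNa : ∀ A B : Matrix (Fin n) (Fin n) ℂ, N (A + B) ≤ N A + N B)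
    (hUI : ∀ U V A : Matrix (Fin n) (Fin n) ℂ, U ∈ Matrix.unitaryGroup (Fin n) ℂ →
      V ∈ Matrix.unitaryGroup (Fin n) ℂ → N (U * A * V) = N A)
    (hSM : ∀ A B : Matrix (Fin n) (Fin n) ℂ, N (A * B) ≤ N A * N B)
    {α₁ α₂ : ℝ} (hα₁0 : 0 ≤ α₁) (hα₁1 : α₁ < Real.pi / 2)
    (hα₂0 : 0 ≤ α₂) (hα₂1 : α₂ < Real.pi / 2)
    (X Y : Matrix (Fin n) (Fin n) ℂ)
    (hX : X ∈ sectClass n α₁) (hY : Y ∈ sectClass n α₂) :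
    gnr N (Matrix.hadamard X Y) ≤
      (Real.cos α₁)⁻¹ * (Real.cos α₂)⁻¹ * gnr N X * gnr N Y := by
  have h : UIN N := ⟨hN0, hNs, hNa, hUI, hSM⟩
  obtain ⟨z₁, hz₁, hA⟩ := hX
  obtain ⟨z₂, hz₂, hB⟩ := hY
  have c1 : 0 < Real.cos α₁ := Real.cos_pos_of_mem_Ioo ⟨by linarith [Real.pi_pos], hα₁1⟩
  have c2 : 0 < Real.cos α₂ := Real.cos_pos_of_mem_Ioo ⟨by linarith [Real.pi_pos], hα₂1⟩
  have n1 : z₁ ≠ 0 := by rintro rfl; simp at hz₁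
  have n2 : z₂ ≠ 0 := by rintro rfl; simp at hz₂
  unfold gnr
  refine ciSup_le fun θ => ?_
  have e : Complex.exp (θ * Complex.I) • Matrix.hadamard X Y =
      (Complex.exp (θ * Complex.I) * z₁⁻¹ * z₂⁻¹) • Matrix.hadamard (z₁ • X) (z₂ • Y) := by
    ext i j
    simp
    field_simp
  rw [e]
  have hb := main_bound h hα₁0 hα₁1 hα₂0 hα₂1 (z₁ • X) (z₂ • Y) hA hB
    (Complex.exp (θ * Complex.I) * z₁⁻¹ * z₂⁻¹)
    (by rw [norm_mul, norm_mul, norm_inv, norm_inv, hz₁, hz₂, Complex.norm_exp_ofReal_mul_I]; simp)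
  refine hb.trans ?_
  have g1 := h.le_gnr X z₁ hz₁
  have g2 := h.le_gnr Y z₂ hz₂
  change _ ≤ (Real.cos α₁)⁻¹ * (Real.cos α₂)⁻¹ * gnr N X * gnr N Y
  have hs0 : 0 ≤ (Real.cos α₁)⁻¹ * (Real.cos α₂)⁻¹ := by positivity
  have k1 := h.nonneg (matRe (z₁ • X))
  have k2 := h.nonneg (matRe (z₂ • Y))
  exact mul_le_mul (mul_le_mul_of_nonneg_left g1 hs0) g2 k2 (mul_nonneg hs0 (k1.trans g1))
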